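/- Let Θ be a suitable set of moduli of continuity. If f : ℝ × ℝ^N → ℝ^M is weak Θ-Carathéodory and t ∈ ℝ, then the time translation f_t defined by f_t(s,x) := f(s + t, x) is also weak Θ-Carathéodory. -/

import Mathlib

open MeasureTheory Set Filter Topology
open scoped RealInnerProductSpace

noncomputable section

abbrev Euc (n : ℕ) := EuclideanSpace ℝ (Fin n)

/-- A function `ℝ → ℝ` is locally integrable (w.r.t. Lebesgue measure) on every
compact interval. -/
def LocInt (m : ℝ → ℝ) : Prop := ∀ a b : ℝ, IntegrableOn m (Icc a b)

section Defs

variable {N : ℕ} {F : Type*} [NormedAddCommGroup F] [NormedSpace ℝ F]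

/-- The Carathéodory conditions (C1) and (C2). -/
def IsCara (f : ℝ → Euc N → F) : Prop :=
  StronglyMeasurable (Function.uncurry f) ∧
  ∀ K : Set (Euc N), IsCompact K → ∃ m : ℝ → ℝ, (∀ t, 0 ≤ m t) ∧ LocInt m ∧
    ∀ᵐ t : ℝ, ∀ x ∈ K, ‖f t x‖ ≤ m t

/-- A suitable set of moduli of continuity `Θ = {θ_j^{[q₁,q₂]}}`. -/
structure SuitableModuli where
  θ : ℕ → ℚ → ℚ → ℝ → ℝ
  nonneg : ∀ j q₁ q₂ s, (0:ℝ) ≤ s → 0 ≤ θ j q₁ q₂ s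
  cont : ∀ j q₁ q₂, ContinuousOn (θ j q₁ q₂) (Ici 0)
  mono : ∀ j q₁ q₂, MonotoneOn (θ j q₁ q₂) (Ici 0)
  zero : ∀ j q₁ q₂, θ j q₁ q₂ 0 = 0
  ordered : ∀ j₁ j₂ q₁ q₂ p₁ p₂, j₁ ≤ j₂ → p₁ ≤ q₁ → q₂ ≤ p₂ →
    ∀ s : ℝ, 0 ≤ s → θ j₁ q₁ q₂ s ≤ θ j₂ p₁ p₂ s

/-- `x ∈ K_j^{[q₁,q₂]}`: continuous, bounded by `j` and with modulus of continuity
`θ_j^{[q₁,q₂]}` on `[q₁,q₂]`. -/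
def inK {N : ℕ} (Θ : SuitableModuli) (j : ℕ) (q₁ q₂ : ℚ) (x : ℝ → Euc N) : Prop :=
  ContinuousOn x (Icc (q₁:ℝ) (q₂:ℝ)) ∧
  (∀ t ∈ Icc (q₁:ℝ) (q₂:ℝ), ‖x t‖ ≤ (j:ℝ)) ∧
  ∀ t ∈ Icc (q₁:ℝ) (q₂:ℝ), ∀ s ∈ Icc (q₁:ℝ) (q₂:ℝ), ‖x t - x s‖ ≤ Θ.θ j q₁ q₂ |t - s|

/-- Weak Θ-Carathéodory functions: Carathéodory conditions plus condition (W). -/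
def IsWTC (Θ : SuitableModuli) (f : ℝ → Euc N → F) : Prop :=
  IsCara f ∧
  ∀ (j : ℕ) (q₁ q₂ : ℚ) (xs : ℕ → ℝ → Euc N) (x : ℝ → Euc N),
    (∀ n, inK Θ j q₁ q₂ (xs n)) → inK Θ j q₁ q₂ x →
    TendstoUniformlyOn (fun n t => xs n t) x atTop (Icc (q₁:ℝ) (q₂:ℝ)) →
    Tendsto (fun n => ∫ t in Icc (q₁:ℝ) (q₂:ℝ), f t (xs n t)) atTop
      (𝓝 (∫ t in Icc (q₁:ℝ) (q₂:ℝ), f t (x t)))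

/-- Convergence in the `σ_Θ` sense:
`sup_{x ∈ K_j^I} ‖∫_I (f_n(t,x(t)) − f(t,x(t))) dt‖ → 0` for every `j` and `I`. -/
def SigmaTendsto (Θ : SuitableModuli) (fs : ℕ → ℝ → Euc N → F) (f : ℝ → Euc N → F) : Prop :=
  ∀ (j : ℕ) (q₁ q₂ : ℚ), ∀ ε > (0:ℝ), ∀ᶠ n in atTop, ∀ x : ℝ → Euc N, inK Θ j q₁ q₂ x →
    ‖∫ t in Icc (q₁:ℝ) (q₂:ℝ), (fs n t (x t) - f t (x t))‖ < ε

end Defs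

/-- Lipschitz Carathéodory functions. -/
def IsLC {N : ℕ} (f : ℝ → Euc N → Euc N) : Prop :=
  IsCara f ∧
  ∀ K : Set (Euc N), IsCompact K → ∃ l : ℝ → ℝ, LocInt l ∧
    ∀ᵐ t : ℝ, ∀ x ∈ K, ∀ y ∈ K, ‖f t x - f t y‖ ≤ l t * ‖x - y‖

/-- The optimal m-bound of `f` on the closed ball `B_j`. -/
def mOpt {N : ℕ} (f : ℝ → Euc N → Euc N) (j : ℕ) (t : ℝ) : ℝ :=
  sSup {v : ℝ | ∃ x : Euc N, ‖x‖ ≤ (j:ℝ) ∧ v = ‖f t x‖}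

/-- The time translation `f_r(s,x) = f(s+r,x)`. -/
def timeTranslate {N : ℕ} (f : ℝ → Euc N → Euc N) (r : ℝ) : ℝ → Euc N → Euc N :=
  fun s x => f (s + r) x

/-- `x` is a solution of `ẋ = g(t,x)`, `x(0) = x₀`, defined on `[0,∞)`. -/
def IsSolOn {N : ℕ} (g : ℝ → Euc N → Euc N) (x₀ : Euc N) (x : ℝ → Euc N) : Prop :=
  ContinuousOn x (Ici 0) ∧ ∀ t ∈ Ici (0:ℝ), x t = x₀ + ∫ s in (0:ℝ)..t, g s (x s)

section Translation

variable {N : ℕ} {F : Type*} [NormedAddCommGroup F]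

theorem LocInt.intervalIntegrable {m : ℝ → ℝ} (hm : LocInt m) (a b : ℝ) :
    IntervalIntegrable m volume a b :=
  (hm (min a b) (max a b)).intervalIntegrable

theorem LocInt.comp_add_right {m : ℝ → ℝ} (hm : LocInt m) (t : ℝ) :
    LocInt (fun s => m (s + t)) := by
  intro a b
  have h := ((measurePreserving_add_right volume t).integrableOn_comp_preimage
    (measurableEmbedding_addRight t)).2 (hm (a + t) (b + t))
  simpa [Function.comp_def] using h

theorem IsCara.comp_add_right {f : ℝ → Euc N → F} (hf : IsCara f) (t : ℝ) :
    IsCara (fun s x => f (s + t) x) := by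
  refine ⟨hf.1.comp_measurable (g := fun p : ℝ × Euc N => (p.1 + t, p.2)) (by fun_prop), ?_⟩
  intro K hK
  obtain ⟨m, hm0, hm, hb⟩ := hf.2 K hK
  exact ⟨fun s => m (s + t), fun s => hm0 _, hm.comp_add_right t,
    (measurePreserving_add_right volume t).quasiMeasurePreserving.ae hb⟩

/-- Along curves with values in a fixed ball, a Carathéodory function is dominated by a single
locally integrable function. -/
theorem IsCara.exists_bound {f : ℝ → Euc N → F} (hf : IsCara f) (j : ℕ) :
    ∃ m : ℝ → ℝ, LocInt m ∧
      ∀ y : ℝ → Euc N, (∀ u, ‖y u‖ ≤ j) → ∀ᵐ u : ℝ, ‖f u (y u)‖ ≤ m u := by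
  obtain ⟨m, -, hm, hb⟩ := hf.2 (Metric.closedBall 0 j) (isCompact_closedBall _ _)
  refine ⟨m, hm, fun y hy => ?_⟩
  filter_upwards [hb] with u hu
  exact hu _ (by simpa using hy u)

theorem IsCara.intervalIntegrable {f : ℝ → Euc N → F} (hf : IsCara f) {j : ℕ}
    {y : ℝ → Euc N} (hy : Measurable y) (hj : ∀ u, ‖y u‖ ≤ j) (a b : ℝ) :
    IntervalIntegrable (fun u => f u (y u)) volume a b := by
  obtain ⟨m, hm, hb⟩ := hf.exists_bound j
  refine (hm.intervalIntegrable a b).mono_fun'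
    (hf.1.comp_measurable (measurable_id.prodMk hy)).aestronglyMeasurable ?_
  exact ae_restrict_of_ae (hb y hj)

theorem inK_const (Θ : SuitableModuli) {j : ℕ} {c : Euc N} (hc : ‖c‖ ≤ j) (q₁ q₂ : ℚ) :
    inK Θ j q₁ q₂ (fun _ => c) :=
  ⟨continuousOn_const, fun _ _ => hc, fun _ _ _ _ => by
    simpa using Θ.nonneg _ _ _ _ (abs_nonneg _)⟩

variable [NormedSpace ℝ F]

/-- For constant curves, condition (W) holds on all intervals, with endpoints rational or not. -/
theorem IsWTC.tendsto_integral_const {Θ : SuitableModuli} {f : ℝ → Euc N → F}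
    (hf : IsWTC Θ f) {j : ℕ} {cs : ℕ → Euc N} {c : Euc N} (hcs : ∀ n, ‖cs n‖ ≤ j)
    (hc : ‖c‖ ≤ j) (h : Tendsto cs atTop (𝓝 c)) (a b : ℝ) :
    Tendsto (fun n => ∫ u in a..b, f u (cs n)) atTop (𝓝 (∫ u in a..b, f u c)) := by
  have hle : ∀ p q : ℚ, p ≤ q → Tendsto (fun n => ∫ u in (p : ℝ)..q, f u (cs n)) atTop
      (𝓝 (∫ u in (p : ℝ)..q, f u c)) := by
    intro p q hpq
    have hpq' : (p : ℝ) ≤ q := by exact_mod_cast hpq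
    simp only [intervalIntegral.integral_of_le hpq', ← integral_Icc_eq_integral_Ioc]
    refine hf.2 j p q (fun n _ => cs n) (fun _ => c) (fun n => inK_const Θ (hcs n) p q)
      (inK_const Θ hc p q) ?_
    rw [Metric.tendstoUniformlyOn_iff]
    intro ε hε
    filter_upwards [Metric.tendsto_nhds.1 h ε hε] with n hn u _
    rwa [dist_comm]
  have hrat : ∀ q : ℚ, Tendsto (fun n => ∫ u in (0 : ℝ)..q, f u (cs n)) atTop
      (𝓝 (∫ u in (0 : ℝ)..q, f u c)) := by
    intro q
    rcases le_total 0 q with hq | hq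
    · simpa using hle 0 q hq
    · simp only [intervalIntegral.integral_symm (q : ℝ) 0]
      simpa using (hle q 0 hq).neg
  obtain ⟨m, hm, hb⟩ := hf.1.exists_bound j
  have hint : ∀ d : Euc N, ‖d‖ ≤ j → ∀ a b : ℝ,
      IntervalIntegrable (fun u => f u d) volume a b := fun d hd =>
    hf.1.intervalIntegrable measurable_const (fun _ => hd)
  have hreal : ∀ r : ℝ, Tendsto (fun n => ∫ u in (0 : ℝ)..r, f u (cs n)) atTop
      (𝓝 (∫ u in (0 : ℝ)..r, f u c)) := by
    intro r
    rw [Metric.tendsto_nhds]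
    intro ε hε
    have hcont : Continuous fun q : ℝ => |∫ u in q..r, m u| := by
      simp only [intervalIntegral.integral_symm r]
      exact (intervalIntegral.continuous_primitive hm.intervalIntegrable r).neg.abs
    obtain ⟨q, hq⟩ := Rat.denseRange_cast.exists_mem_open
      (isOpen_lt hcont (continuous_const (y := ε / 3))) ⟨r, by simpa using hε⟩
    have hclose : ∀ d : Euc N, ‖d‖ ≤ j →
        dist (∫ u in (0 : ℝ)..r, f u d) (∫ u in (0 : ℝ)..q, f u d) < ε / 3 := by
      intro d hd
      rw [dist_eq_norm, intervalIntegral.integral_interval_sub_left (hint d hd _ _)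
        (hint d hd _ _)]
      exact (intervalIntegral.norm_integral_le_abs_of_norm_le
        (ae_restrict_of_ae (hb (fun _ => d) fun _ => hd))
        (hm.intervalIntegrable _ _)).trans_lt hq
    filter_upwards [Metric.tendsto_nhds.1 (hrat q) (ε / 3) (by positivity)] with n hn
    have h1 := hclose _ (hcs n)
    have h2 := hclose c hc
    rw [dist_comm] at h2
    linarith [dist_triangle4 (∫ u in (0 : ℝ)..r, f u (cs n)) (∫ u in (0 : ℝ)..q, f u (cs n))
      (∫ u in (0 : ℝ)..q, f u c) (∫ u in (0 : ℝ)..r, f u c)]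
  have hsub : ∀ d : Euc N, ‖d‖ ≤ j →
      ∫ u in a..b, f u d = (∫ u in (0 : ℝ)..b, f u d) - ∫ u in (0 : ℝ)..a, f u d :=
    fun d hd => (intervalIntegral.integral_interval_sub_left (hint d hd _ _) (hint d hd _ _)).symm
  rw [hsub c hc]
  simp only [fun n => hsub _ (hcs n)]
  exact (hreal b).sub (hreal a)

/-- The curve `x` on `[a, b]`, extended by constants to the real line and shifted by `t`. -/
def shiftExtend {a b : ℝ} (hab : a ≤ b) (t : ℝ) (x : ℝ → Euc N) (u : ℝ) : Euc N :=
  x (projIcc a b hab (u - t))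

theorem inK.continuous_shiftExtend {Θ : SuitableModuli} {j : ℕ} {q₁ q₂ : ℚ} {x : ℝ → Euc N}
    (hx : inK Θ j q₁ q₂ x) (hq : (q₁ : ℝ) ≤ q₂) (t : ℝ) : Continuous (shiftExtend hq t x) :=
  (continuousOn_iff_continuous_domRestrict.1 hx.1).comp
    (continuous_projIcc.comp (continuous_id.sub continuous_const))

theorem inK.norm_shiftExtend_le {Θ : SuitableModuli} {j : ℕ} {q₁ q₂ : ℚ} {x : ℝ → Euc N}
    (hx : inK Θ j q₁ q₂ x) (hq : (q₁ : ℝ) ≤ q₂) (t u : ℝ) : ‖shiftExtend hq t x u‖ ≤ j :=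
  hx.2.1 _ (projIcc _ _ hq _).2

theorem inK.shiftExtend {Θ : SuitableModuli} {j : ℕ} {q₁ q₂ p₁ p₂ : ℚ} {x : ℝ → Euc N}
    (hx : inK Θ j q₁ q₂ x) (hq : (q₁ : ℝ) ≤ q₂) (t : ℝ) (h₁ : p₁ ≤ q₁) (h₂ : q₂ ≤ p₂) :
    inK Θ j p₁ p₂ (shiftExtend hq t x) := by
  refine ⟨(hx.continuous_shiftExtend hq t).continuousOn,
    fun u _ => hx.norm_shiftExtend_le hq t u, fun u _ v _ => ?_⟩
  have hdist : |(projIcc (q₁ : ℝ) q₂ hq (u - t) : ℝ) - projIcc (q₁ : ℝ) q₂ hq (v - t)|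
      ≤ |u - v| := by
    simpa using abs_projIcc_sub_projIcc (c := u - t) (d := v - t) hq
  calc _ ≤ Θ.θ j q₁ q₂ _ := hx.2.2 _ (projIcc _ _ hq _).2 _ (projIcc _ _ hq _).2
    _ ≤ Θ.θ j q₁ q₂ |u - v| :=
      Θ.mono _ _ _ (mem_Ici.2 (abs_nonneg _)) (mem_Ici.2 (abs_nonneg _)) hdist
    _ ≤ Θ.θ j p₁ p₂ |u - v| := Θ.ordered _ _ _ _ _ _ le_rfl h₁ h₂ _ (abs_nonneg _)

/-- The integral of the translated function along `x`, written through the constant extension of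
the shifted curve to a larger interval. -/
theorem IsCara.integral_translate_eq {Θ : SuitableModuli} {f : ℝ → Euc N → F} (hf : IsCara f)
    {j : ℕ} {q₁ q₂ : ℚ} {x : ℝ → Euc N} (hx : inK Θ j q₁ q₂ x) (hq : (q₁ : ℝ) ≤ q₂)
    {t a b : ℝ} (ha : a ≤ q₁ + t) (hb : q₂ + t ≤ b) :
    ∫ s in Icc (q₁ : ℝ) q₂, f (s + t) (x s) =
      (∫ u in Icc a b, f u (shiftExtend hq t x u)) - (∫ u in a..q₁ + t, f u (x q₁))
        - ∫ u in q₂ + t..b, f u (x q₂) := by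
  have hint := hf.intervalIntegrable (hx.continuous_shiftExtend hq t).measurable
    (hx.norm_shiftExtend_le hq t)
  have hmid : ∫ s in Icc (q₁ : ℝ) q₂, f (s + t) (x s) =
      ∫ u in q₁ + t..q₂ + t, f u (shiftExtend hq t x u) := by
    rw [← intervalIntegral.integral_comp_add_right
      (fun u => f u (shiftExtend hq t x u)) t, intervalIntegral.integral_of_le hq,
      ← integral_Icc_eq_integral_Ioc]
    refine setIntegral_congr_fun measurableSet_Icc fun s hs => ?_
    simp [_root_.shiftExtend, projIcc_of_mem hq hs]
  have hleft : ∫ u in a..q₁ + t, f u (x q₁) =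
      ∫ u in a..q₁ + t, f u (shiftExtend hq t x u) := by
    refine intervalIntegral.integral_congr fun u hu => ?_
    rw [uIcc_of_le ha] at hu
    simp only [_root_.shiftExtend, projIcc_of_le_left hq (sub_le_iff_le_add.2 hu.2)]
  have hright : ∫ u in q₂ + t..b, f u (x q₂) =
      ∫ u in q₂ + t..b, f u (shiftExtend hq t x u) := by
    refine intervalIntegral.integral_congr fun u hu => ?_
    rw [uIcc_of_le hb] at hu
    simp only [_root_.shiftExtend, projIcc_of_right_le hq (le_sub_iff_add_le.2 hu.1)]
  have hab : a ≤ b := by linarith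
  rw [hmid, hleft, hright, integral_Icc_eq_integral_Ioc, ← intervalIntegral.integral_of_le hab,
    ← intervalIntegral.integral_add_adjacent_intervals (hint a (q₁ + t)) (hint (q₁ + t) b),
    ← intervalIntegral.integral_add_adjacent_intervals (hint (q₁ + t) (q₂ + t))
      (hint (q₂ + t) b)]
  abel

end Translation

/-- The time translation of a weak Θ-Carathéodory function is again
weak Θ-Carathéodory. -/
theorem stmt3 {N M : ℕ} (Θ : SuitableModuli) (f : ℝ → Euc N → Euc M)
    (hf : IsWTC Θ f) (t : ℝ) :
    IsWTC Θ (fun s x => f (s + t) x) := by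
  refine ⟨hf.1.comp_add_right t, fun j q₁ q₂ xs x hxs hx hlim => ?_⟩
  rcases lt_or_ge (q₂ : ℝ) q₁ with hq | hq
  · simp [Icc_eq_empty_of_lt hq]
  obtain ⟨p₁, hp₁⟩ := exists_rat_lt (min (q₁ : ℝ) (q₁ + t))
  obtain ⟨p₂, hp₂⟩ := exists_rat_gt (max (q₂ : ℝ) (q₂ + t))
  have h₁ : p₁ ≤ q₁ := by exact_mod_cast (hp₁.trans_le (min_le_left _ _)).le
  have h₂ : q₂ ≤ p₂ := by exact_mod_cast ((le_max_left _ _).trans_lt hp₂).le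
  have ha : (p₁ : ℝ) ≤ q₁ + t := (hp₁.trans_le (min_le_right _ _)).le
  have hb : q₂ + t ≤ (p₂ : ℝ) := ((le_max_right _ _).trans_lt hp₂).le
  have hl : (q₁ : ℝ) ∈ Icc (q₁ : ℝ) q₂ := left_mem_Icc.2 hq
  have hr : (q₂ : ℝ) ∈ Icc (q₁ : ℝ) q₂ := right_mem_Icc.2 hq
  have hunif : TendstoUniformlyOn (fun n => shiftExtend hq t (xs n)) (shiftExtend hq t x) atTop
      (Icc (p₁ : ℝ) p₂) := by
    rw [Metric.tendstoUniformlyOn_iff] at hlim ⊢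
    intro ε hε
    filter_upwards [hlim ε hε] with n hn u _
    exact hn _ (projIcc _ _ hq _).2
  simp only [hf.1.integral_translate_eq hx hq ha hb,
    fun n => hf.1.integral_translate_eq (hxs n) hq ha hb]
  exact ((hf.2 j p₁ p₂ _ _ (fun n => (hxs n).shiftExtend hq t h₁ h₂)
    (hx.shiftExtend hq t h₁ h₂) hunif).sub
    (hf.tendsto_integral_const (fun n => (hxs n).2.1 _ hl) (hx.2.1 _ hl)
      (hlim.tendsto_at hl) _ _)).sub
    (hf.tendsto_integral_const (fun n => (hxs n).2.1 _ hr) (hx.2.1 _ hr)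
      (hlim.tendsto_at hr) _ _)
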